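/- arXiv:2301.04759 — 2 statements merged into one kernel-verified Lean document; each statement's English description precedes it below -/
import Mathlib

section
/- For any 0 ≤ k, l ≤ d−1 with k ≠ l, the difference Ω_k − Ω_l extends to an entire function: there exists an entire function H : ℂ → ℂ with H(s) = Ω_k(s) − Ω_l(s) for all Re s > 0; equivalently, the meromorphic continuations satisfy that F_k − F_l is entire (the simple poles at nonpositive integers cancel, since the residues of all F_k at each nonpositive integer coincide). -/
/-- The polynomial `P₀(t) = -t^d/d + ∑_{k=1}^{d-1} a_k t^k`. -/
noncomputable def P0 (d : ℕ) (a : ℕ → ℂ) (t : ℂ) : ℂ :=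
  -t ^ d / (d : ℂ) + ∑ k ∈ Finset.Ico 1 d, a k * t ^ k

/-- The Omega function `Ω_k(s) = e^{2πiks/d} ∫_0^∞ u^{s-1} e^{P₀(ω_k u)} du`, for `Re s > 0`,
where `ω_k = e^{2πik/d}` and `u^{s-1} = exp((s-1) log u)` for real `u > 0`. -/
noncomputable def OmegaFn (d : ℕ) (a : ℕ → ℂ) (k : ℕ) (s : ℂ) : ℂ :=
  Complex.exp (2 * Real.pi * Complex.I * k * s / d) *
    ∫ u in Set.Ioi (0 : ℝ),
      (u : ℂ) ^ (s - 1) *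
        Complex.exp (P0 d a (Complex.exp (2 * Real.pi * Complex.I * k / d) * u))

open Filter Topology MeasureTheory Set

/-- Parameter integrals of `exp (θ i s)` against a continuous function over a bounded interval are
entire in `s`. -/
lemma differentiable_intervalIntegral_exp_mul {h : ℝ → ℂ} (hh : Continuous h) (a b : ℝ) :
    Differentiable ℂ fun s : ℂ => ∫ θ in a..b, Complex.exp (θ * Complex.I * s) * h θ := by
  intro s₀
  have hcont : Continuous fun p : ℂ × ℝ =>
      Complex.exp (p.2 * Complex.I * p.1) * (p.2 * Complex.I) * h p.2 := by fun_prop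
  obtain ⟨C, hC⟩ := ((isCompact_closedBall s₀ 1).prod (isCompact_uIcc (a := a) (b := b)))
    |>.exists_bound_of_continuousOn hcont.continuousOn
  refine (intervalIntegral.hasDerivAt_integral_of_dominated_loc_of_deriv_le
    (F' := fun s θ => Complex.exp (θ * Complex.I * s) * (θ * Complex.I) * h θ)
    (bound := fun _ => C) (Metric.ball_mem_nhds s₀ one_pos) ?_ ?_ ?_ ?_ ?_ ?_).2.differentiableAt
  · exact Eventually.of_forall fun s => (by fun_prop : Continuous fun θ : ℝ =>
      Complex.exp (θ * Complex.I * s) * h θ).aestronglyMeasurable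
  · exact (by fun_prop : Continuous fun θ : ℝ =>
      Complex.exp (θ * Complex.I * s₀) * h θ).intervalIntegrable _ _
  · exact (by fun_prop : Continuous fun θ : ℝ =>
      Complex.exp (θ * Complex.I * s₀) * (θ * Complex.I) * h θ).aestronglyMeasurable
  · exact Eventually.of_forall fun θ hθ s hs =>
      hC (s, θ) ⟨Metric.ball_subset_closedBall hs, uIoc_subset_uIcc hθ⟩
  · exact intervalIntegrable_const
  · refine Eventually.of_forall fun θ _ s _ => HasDerivAt.mul_const ?_ _
    simpa using ((hasDerivAt_id s).const_mul (θ * Complex.I : ℂ)).cexp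

lemma intervalIntegrable_cpow_mul {s : ℂ} (hs : 0 < s.re) {h : ℝ → ℂ} (hh : Continuous h) :
    IntervalIntegrable (fun u : ℝ => (u : ℂ) ^ (s - 1) * h u) volume 0 1 :=
  (intervalIntegral.intervalIntegrable_cpow' (by simpa using hs)).mul_continuousOn hh.continuousOn

/-- Integration by parts for the truncated Mellin transform along a ray. -/
lemma truncated_mellin_by_parts {f : ℂ → ℂ} (hf : Differentiable ℂ f) {s : ℂ} (hs : 0 < s.re)
    (w : ℂ) :
    s * (∫ u in (0 : ℝ)..1, (u : ℂ) ^ (s - 1) * f (w * u)) +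
      ∫ u in (0 : ℝ)..1, (u : ℂ) ^ (s - 1) * (w * u * deriv f (w * u)) = f w := by
  have hf' : Continuous (deriv f) := (hf.contDiff (n := 1)).continuous_deriv le_rfl
  have hfc : Continuous f := hf.continuous
  have hs0 : s ≠ 0 := by rintro rfl; simp at hs
  have h1 := intervalIntegrable_cpow_mul hs (h := fun u : ℝ => f (w * u)) (by fun_prop)
  have h2 := intervalIntegrable_cpow_mul hs (h := fun u : ℝ => w * u * deriv f (w * u))
    (by fun_prop)
  rw [← intervalIntegral.integral_const_mul, ← intervalIntegral.integral_add (h1.const_mul s) h2,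
    intervalIntegral.integral_eq_sub_of_hasDerivAt_of_le (f := fun u : ℝ => (u : ℂ) ^ s * f (w * u))
      zero_le_one _ _ ((h1.const_mul s).add h2)]
  · simp [hs0]
  · exact ((Complex.continuous_ofReal_cpow_const hs).mul (by fun_prop)).continuousOn
  · rintro u ⟨hu, -⟩
    have hu' : (u : ℂ) ≠ 0 := by exact_mod_cast hu.ne'
    have e1 : HasDerivAt (fun u : ℝ => (u : ℂ) ^ s) (s * (u : ℂ) ^ (s - 1)) u := by
      simpa using ((hasDerivAt_id (u : ℂ)).cpow_const (c := s)
        (by simp [Complex.mem_slitPlane_iff, hu])).comp_ofReal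
    have e2 : HasDerivAt (fun u : ℝ => f (w * u)) (deriv f (w * u) * w) u := by
      have := (hf (w * u)).hasDerivAt.comp (u : ℂ) ((hasDerivAt_id (u : ℂ)).const_mul w)
      simpa [Function.comp_def] using this.comp_ofReal
    refine (e1.mul e2).congr_deriv ?_
    rw [Complex.cpow_sub _ _ hu', Complex.cpow_one]
    field_simp

/-- The truncated Mellin transform of an entire function along the ray of angle `θ` has
derivative in `θ` given by the boundary value on the unit circle. -/
lemma hasDerivAt_truncated_mellin_ray {f : ℂ → ℂ} (hf : Differentiable ℂ f) {s : ℂ}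
    (hs : 0 < s.re) (θ : ℝ) :
    HasDerivAt (fun θ : ℝ => Complex.exp (θ * Complex.I * s) *
        ∫ u in (0 : ℝ)..1, (u : ℂ) ^ (s - 1) * f (Complex.exp (θ * Complex.I) * u))
      (Complex.exp (θ * Complex.I * s) * (Complex.I * f (Complex.exp (θ * Complex.I)))) θ := by
  have hf' : Continuous (deriv f) := (hf.contDiff (n := 1)).continuous_deriv le_rfl
  have hfc : Continuous f := hf.continuous
  obtain ⟨C, hC⟩ := (isCompact_closedBall (0 : ℂ) 1).exists_bound_of_continuousOn
    (f := fun z => Complex.I * (z * deriv f z)) (by fun_prop)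
  have hB : HasDerivAt (fun θ : ℝ =>
      ∫ u in (0 : ℝ)..1, (u : ℂ) ^ (s - 1) * f (Complex.exp (θ * Complex.I) * u))
      (∫ u in (0 : ℝ)..1, (u : ℂ) ^ (s - 1) * (Complex.I * (Complex.exp (θ * Complex.I) * u *
        deriv f (Complex.exp (θ * Complex.I) * u)))) θ := by
    refine (intervalIntegral.hasDerivAt_integral_of_dominated_loc_of_deriv_le
      (F' := fun (θ : ℝ) (u : ℝ) => (u : ℂ) ^ (s - 1) * (Complex.I *
        (Complex.exp (θ * Complex.I) * u * deriv f (Complex.exp (θ * Complex.I) * u))))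
      (bound := fun u => ‖(u : ℂ) ^ (s - 1)‖ * C) univ_mem ?_ ?_ ?_ ?_ ?_ ?_).2
    · exact Eventually.of_forall fun φ => (intervalIntegrable_iff.1 (intervalIntegrable_cpow_mul hs
        (h := fun u : ℝ => f (Complex.exp (φ * Complex.I) * u))
        (by fun_prop))).aestronglyMeasurable
    · exact intervalIntegrable_cpow_mul hs (h := fun u : ℝ => f (Complex.exp (θ * Complex.I) * u))
        (by fun_prop)
    · exact (intervalIntegrable_iff.1 (intervalIntegrable_cpow_mul hs
        (h := fun u : ℝ => Complex.I * (Complex.exp (θ * Complex.I) * u *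
          deriv f (Complex.exp (θ * Complex.I) * u))) (by fun_prop))).aestronglyMeasurable
    · refine Eventually.of_forall fun u hu φ _ => ?_
      rw [uIoc_of_le zero_le_one] at hu
      rw [norm_mul]
      gcongr
      refine hC _ ?_
      simpa [Complex.norm_exp_ofReal_mul_I, abs_of_pos hu.1] using hu.2
    · exact (intervalIntegral.intervalIntegrable_cpow' (by simpa using hs)).norm.mul_const C
    · refine Eventually.of_forall fun u _ φ _ => HasDerivAt.const_mul _ ?_
      have e : HasDerivAt (fun z : ℂ => f (Complex.exp (z * Complex.I) * u))
          (deriv f (Complex.exp (φ * Complex.I) * u) *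
            (Complex.exp (φ * Complex.I) * (1 * Complex.I) * u)) φ :=
        (hf _).hasDerivAt.comp (φ : ℂ)
          ((((hasDerivAt_id (φ : ℂ)).mul_const Complex.I).cexp).mul_const (u : ℂ))
      exact e.comp_ofReal.congr_deriv (by ring)
  have hE : HasDerivAt (fun θ : ℝ => Complex.exp (θ * Complex.I * s))
      (Complex.exp (θ * Complex.I * s) * (1 * Complex.I * s)) θ :=
    ((((hasDerivAt_id (θ : ℂ)).mul_const Complex.I).mul_const s).cexp).comp_ofReal
  refine (hE.mul hB).congr_deriv ?_
  have key := truncated_mellin_by_parts hf hs (Complex.exp (θ * Complex.I))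
  simp only [mul_left_comm _ Complex.I, intervalIntegral.integral_const_mul]
  rw [← key]
  ring

/-- The difference of truncated Mellin transforms along two rays is an integral over an arc. -/
lemma truncated_mellin_ray_sub {f : ℂ → ℂ} (hf : Differentiable ℂ f) {s : ℂ}
    (hs : 0 < s.re) (α β : ℝ) :
    Complex.exp (β * Complex.I * s) *
        (∫ u in (0 : ℝ)..1, (u : ℂ) ^ (s - 1) * f (Complex.exp (β * Complex.I) * u)) -
      Complex.exp (α * Complex.I * s) *
        (∫ u in (0 : ℝ)..1, (u : ℂ) ^ (s - 1) * f (Complex.exp (α * Complex.I) * u)) =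
    ∫ θ in α..β, Complex.exp (θ * Complex.I * s) *
      (Complex.I * f (Complex.exp (θ * Complex.I))) := by
  have hfc : Continuous f := hf.continuous
  exact (intervalIntegral.integral_eq_sub_of_hasDerivAt
    (fun θ _ => hasDerivAt_truncated_mellin_ray hf hs θ)
    ((by fun_prop : Continuous fun θ : ℝ => Complex.exp (θ * Complex.I * s) *
      (Complex.I * f (Complex.exp (θ * Complex.I)))).intervalIntegrable _ _)).symm

/-- For rapidly decaying `g`, the Mellin transform of its tail is entire. -/
lemma differentiable_mellin_indicator {g : ℝ → ℂ} (hg : Continuous g)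
    (hdec : ∀ b : ℝ, g =O[atTop] fun u : ℝ => u ^ (-b)) :
    Differentiable ℂ (mellin ((Ioi (1 : ℝ)).indicator g)) := by
  intro s
  refine mellin_differentiableAt_of_isBigO_rpow (a := s.re + 1) (b := s.re - 1)
    ((hg.locallyIntegrable.indicator measurableSet_Ioi).locallyIntegrableOn _) ?_
    (by linarith) ?_ (by linarith)
  · refine (hdec _).congr' ?_ EventuallyEq.rfl
    filter_upwards [eventually_gt_atTop 1] with u hu
    simp [indicator_of_mem (mem_Ioi.2 hu)]
  · refine (Asymptotics.isBigO_zero _ _).congr' ?_ EventuallyEq.rfl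
    filter_upwards [mem_nhdsWithin_of_mem_nhds (Iio_mem_nhds (zero_lt_one (α := ℝ)))] with u hu
    simp [le_of_lt (mem_Iio.1 hu)]

lemma mellin_eq_truncated_add_tail {g : ℝ → ℂ} (hg : Continuous g)
    (hdec : ∀ b : ℝ, g =O[atTop] fun u : ℝ => u ^ (-b)) {s : ℂ} (hs : 0 < s.re) :
    mellin g s = (∫ u in (0 : ℝ)..1, (u : ℂ) ^ (s - 1) * g u) +
      mellin ((Ioi (1 : ℝ)).indicator g) s := by
  have hconv : MellinConvergent g s := by
    refine mellinConvergent_of_isBigO_rpow (a := s.re + 1) (b := 0)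
      (hg.locallyIntegrable.locallyIntegrableOn _) (hdec _) (by linarith) ?_ hs
    simpa using (hg.continuousAt.mono_left nhdsWithin_le_nhds : Tendsto g (𝓝[>] 0) _).isBigO_one ℝ
  have htail : mellin ((Ioi (1 : ℝ)).indicator g) s =
      ∫ u in Ioi (1 : ℝ), (u : ℂ) ^ (s - 1) * g u := by
    have : ∀ u : ℝ, (u : ℂ) ^ (s - 1) • (Ioi (1 : ℝ)).indicator g u =
        (Ioi (1 : ℝ)).indicator (fun u : ℝ => (u : ℂ) ^ (s - 1) * g u) u := by
      intro u; by_cases hu : u ∈ Ioi (1 : ℝ) <;> simp [hu]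
    simp only [mellin, this]
    rw [setIntegral_indicator measurableSet_Ioi, inter_eq_self_of_subset_right
      (Ioi_subset_Ioi zero_le_one)]
  rw [htail, intervalIntegral.integral_of_le zero_le_one]
  have hconv' : IntegrableOn (fun u : ℝ => (u : ℂ) ^ (s - 1) * g u) (Ioi 0) := hconv
  simp only [mellin, smul_eq_mul]
  rw [← Ioc_union_Ioi_eq_Ioi (zero_le_one (α := ℝ))] at hconv' ⊢
  exact setIntegral_union (Ioc_disjoint_Ioi le_rfl) measurableSet_Ioi
    hconv'.left_of_union hconv'.right_of_union

/-- `exp ∘ P₀` decays rapidly along every ray in the direction of a `d`-th root of unity. -/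
lemma exp_P0_isBigO_rpow {d : ℕ} (hd : 1 ≤ d) (a : ℕ → ℂ) {w : ℂ} (hw : w ^ d = 1) (b : ℝ) :
    (fun u : ℝ => Complex.exp (P0 d a (w * u))) =O[atTop] fun u : ℝ => u ^ (-b) := by
  have hd0 : (0 : ℝ) < d := by exact_mod_cast hd
  have hlow : (fun u : ℝ => ∑ k ∈ Finset.Ico 1 d, a k * (w * u) ^ k) =o[atTop]
      fun u : ℝ => u ^ d := by
    refine Asymptotics.IsLittleO.fun_sum fun k hk => ?_
    simp only [mul_pow, ← mul_assoc]
    refine Asymptotics.IsLittleO.const_mul_left ?_ _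
    refine Asymptotics.IsLittleO.of_norm_left ?_
    simpa using (Asymptotics.isLittleO_pow_pow_atTop_of_lt (𝕜 := ℝ)
      (Finset.mem_Ico.1 hk).2).norm_left
  have hbound : ∀ᶠ u : ℝ in atTop, ‖Complex.exp (P0 d a (w * u))‖ ≤
      1 * ‖Real.exp (-(1 / (2 * d)) * u)‖ := by
    filter_upwards [hlow.def (c := 1 / (2 * d)) (by positivity), eventually_ge_atTop 1]
      with u hu hu1
    have hu0 : 0 ≤ u := zero_le_one.trans hu1
    have hpow : u ≤ u ^ d := le_self_pow₀ hu1 (by omega)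
    rw [Complex.norm_exp, one_mul, Real.norm_of_nonneg (Real.exp_pos _).le, Real.exp_le_exp]
    rw [Real.norm_of_nonneg (by positivity)] at hu
    have hre := (Complex.re_le_norm _).trans hu
    have hmain : (-(w * (u : ℂ)) ^ d / (d : ℂ)).re = -(u ^ d / d) := by
      rw [mul_pow, hw, one_mul, ← neg_div]
      exact_mod_cast Complex.ofReal_re (-u ^ d / d)
    rw [P0, Complex.add_re, hmain]
    have e : u ^ d / d = 1 / (2 * d) * u ^ d + 1 / (2 * d) * u ^ d := by field_simp; norm_num
    have : 1 / (2 * d) * u ≤ 1 / (2 * d) * u ^ d := by gcongr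
    linarith
  exact (Asymptotics.IsBigO.of_bound 1 hbound).trans
    (isLittleO_exp_neg_mul_rpow_atTop (by positivity) _).isBigO

lemma differentiable_exp_P0 (d : ℕ) (a : ℕ → ℂ) :
    Differentiable ℂ fun t => Complex.exp (P0 d a t) := by
  unfold P0
  fun_prop

lemma OmegaFn_eq_exp_mul_mellin (d : ℕ) (a : ℕ → ℂ) (k : ℕ) (s : ℂ) :
    OmegaFn d a k s = Complex.exp ((2 * Real.pi * k / d : ℝ) * Complex.I * s) *
      mellin (fun u : ℝ => Complex.exp (P0 d a
        (Complex.exp ((2 * Real.pi * k / d : ℝ) * Complex.I) * u))) s := by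
  have h1 : ((2 * Real.pi * k / d : ℝ) : ℂ) * Complex.I = 2 * Real.pi * Complex.I * k / d := by
    push_cast; ring
  rw [OmegaFn, mellin, h1]
  simp only [smul_eq_mul]
  congr 2
  ring

lemma exp_two_pi_mul_div_pow {d : ℕ} (hd : d ≠ 0) (k : ℕ) :
    Complex.exp ((2 * Real.pi * k / d : ℝ) * Complex.I) ^ d = 1 := by
  have hd' : (d : ℂ) ≠ 0 := by exact_mod_cast hd
  rw [← Complex.exp_nat_mul, Complex.exp_eq_one_iff]
  refine ⟨k, ?_⟩
  push_cast
  field_simp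

/-- The difference of two Omega functions has an entire extension. -/
lemma exists_entire_OmegaFn_sub {d : ℕ} (hd : 1 ≤ d) (a : ℕ → ℂ) (k l : ℕ) :
    ∃ H : ℂ → ℂ, Differentiable ℂ H ∧
      ∀ s : ℂ, 0 < s.re → H s = OmegaFn d a k s - OmegaFn d a l s := by
  have hf := differentiable_exp_P0 d a
  have hfc : Continuous fun t => Complex.exp (P0 d a t) := hf.continuous
  set α : ℝ := 2 * Real.pi * l / d with hα
  set β : ℝ := 2 * Real.pi * k / d with hβ
  have hcont : ∀ w : ℂ, Continuous fun u : ℝ => Complex.exp (P0 d a (w * u)) := fun w =>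
    hfc.comp (by fun_prop : Continuous fun u : ℝ => w * (u : ℂ))
  have hdα := exp_P0_isBigO_rpow hd a (exp_two_pi_mul_div_pow (by omega : d ≠ 0) l)
  have hdβ := exp_P0_isBigO_rpow hd a (exp_two_pi_mul_div_pow (by omega : d ≠ 0) k)
  rw [← hα] at hdα
  rw [← hβ] at hdβ
  have htα := differentiable_mellin_indicator (hcont _) hdα
  have htβ := differentiable_mellin_indicator (hcont _) hdβ
  have harc := differentiable_intervalIntegral_exp_mul (h := fun θ : ℝ =>
    Complex.I * Complex.exp (P0 d a (Complex.exp (θ * Complex.I))))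
    (continuous_const.mul (hfc.comp
      (by fun_prop : Continuous fun θ : ℝ => Complex.exp (θ * Complex.I)))) α β
  have hexp : ∀ θ : ℝ, Differentiable ℂ fun s : ℂ => Complex.exp (θ * Complex.I * s) :=
    fun θ => by fun_prop
  refine ⟨_, harc.add (((hexp β).mul htβ).sub ((hexp α).mul htα)), fun s hs => ?_⟩
  rw [OmegaFn_eq_exp_mul_mellin, OmegaFn_eq_exp_mul_mellin, ← hα, ← hβ,
    mellin_eq_truncated_add_tail (hcont _) hdα hs, mellin_eq_truncated_add_tail (hcont _) hdβ hs]
  have := truncated_mellin_ray_sub hf hs α β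
  simp only [Pi.add_apply, Pi.sub_apply, Pi.mul_apply]
  rw [← this]
  ring

/-- An identity between functions holomorphic off the nonpositive integers extends from the right
half-plane. -/
lemma eqOn_compl_nonpos_int {f g : ℂ → ℂ}
    (hf : DifferentiableOn ℂ f {s : ℂ | ∀ n : ℕ, s ≠ -(n : ℂ)})
    (hg : DifferentiableOn ℂ g {s : ℂ | ∀ n : ℕ, s ≠ -(n : ℂ)})
    (h : ∀ s : ℂ, 0 < s.re → f s = g s) :
    EqOn f g {s : ℂ | ∀ n : ℕ, s ≠ -(n : ℂ)} := by
  have hU : {s : ℂ | ∀ n : ℕ, s ≠ -(n : ℂ)} = (range fun n : ℕ => -(n : ℂ))ᶜ := by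
    ext s
    simp [eq_comm]
  have hopen : IsOpen {s : ℂ | ∀ n : ℕ, s ≠ -(n : ℂ)} := by
    rw [hU, isOpen_compl_iff]
    have := Complex.isClosedEmbedding_intCast.isClosedMap _
      (isClosed_discrete (range fun n : ℕ => -(n : ℤ)))
    rw [← range_comp] at this
    simpa [Function.comp_def] using this
  have hpre : IsPreconnected {s : ℂ | ∀ n : ℕ, s ≠ -(n : ℂ)} := by
    rw [hU]
    exact ((countable_range _).isConnected_compl_of_one_lt_rank (by simp)).isPreconnected
  refine (hf.analyticOnNhd hopen).eqOn_of_preconnected_of_eventuallyEq (hg.analyticOnNhd hopen)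
    hpre (z₀ := 1) (fun n hn => ?_) ?_
  · have := congrArg Complex.re hn
    have hn0 : (0 : ℝ) ≤ n := n.cast_nonneg
    simp at this
    linarith
  · filter_upwards [(isOpen_lt continuous_const Complex.continuous_re).mem_nhds
      (by simp : (1 : ℂ) ∈ {s : ℂ | 0 < s.re})] with s hs using h s hs

/-- For `k ≠ l`, the difference `Ω_k - Ω_l` extends to an entire function `H`;
equivalently, the meromorphic continuations satisfy that `F_k - F_l` is entire (`H` agrees with
`F_k - F_l` off the nonpositive integers). -/
theorem stmt6 (d : ℕ) (hd : 1 ≤ d) (a : ℕ → ℂ)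
    (k l : ℕ) (hk : k ≤ d - 1) (hl : l ≤ d - 1) (hkl : k ≠ l)
    (F G : ℂ → ℂ)
    (hFdiff : DifferentiableOn ℂ F {s : ℂ | ∀ n : ℕ, s ≠ -(n : ℂ)})
    (hFΩ : ∀ s : ℂ, 0 < s.re → F s = OmegaFn d a k s)
    (hGdiff : DifferentiableOn ℂ G {s : ℂ | ∀ n : ℕ, s ≠ -(n : ℂ)})
    (hGΩ : ∀ s : ℂ, 0 < s.re → G s = OmegaFn d a l s) :
    ∃ H : ℂ → ℂ, Differentiable ℂ H ∧
      (∀ s : ℂ, 0 < s.re → H s = OmegaFn d a k s - OmegaFn d a l s) ∧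
      (∀ s : ℂ, (∀ n : ℕ, s ≠ -(n : ℂ)) → H s = F s - G s) := by
  obtain ⟨H, hH, hHΩ⟩ := exists_entire_OmegaFn_sub hd a k l
  refine ⟨H, hH, hHΩ, fun s hs => ?_⟩
  exact eqOn_compl_nonpos_int (g := fun s => F s - G s) hH.differentiableOn (hFdiff.sub hGdiff)
    (fun s hs => by rw [hHΩ s hs, hFΩ s hs, hGΩ s hs]) hs
end

section
/- Assume d ≥ 2 and let Q ∈ ℂ[t] be a polynomial. Then there exist a polynomial A ∈ ℂ[s, z] and polynomials c_0, …, c_{d−1} ∈ ℂ[s] such that for all s with Re s > 0 and all z ∈ ℂ ∖ (−∞, 0], one has ∫_0^z t^s Q(t) e^{P_0(t)} dt = z^s A(s, z) e^{P_0(z)} + Σ_{k=0}^{d−1} c_k(s) Ω(s+k, z), where the left-hand side is the integral along the straight segment from 0 to z (i.e. z^{s+1} ∫_0^1 u^s Q(uz) e^{P_0(uz)} du, with z^{s+1} and z^s taken with the principal branch of the logarithm). -/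
/-- The Incomplete Omega function `Ω(s,z) = ∫_0^z t^{s-1} e^{P₀(t)} dt`, for `Re s > 0` and
`z ∈ ℂ ∖ (-∞,0]`, defined as `z^s ∫_0^1 u^{s-1} e^{P₀(uz)} du` with the principal branch. -/
noncomputable def OmegaInc (d : ℕ) (a : ℕ → ℂ) (s z : ℂ) : ℂ :=
  z ^ s * ∫ u in (0 : ℝ)..1, (u : ℂ) ^ (s - 1) * Complex.exp (P0 d a (u * z))

section IncompleteOmega

open MeasureTheory

variable {d : ℕ} {a : ℕ → ℂ}

lemma continuous_P0 : Continuous (P0 d a) := by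
  unfold P0
  fun_prop

lemma hasDerivAt_P0_mul (hd : d ≠ 0) (w z : ℂ) :
    HasDerivAt (fun w => P0 d a (w * z))
      ((∑ k ∈ Finset.Ico 1 d, k * a k * (w * z) ^ (k - 1) - (w * z) ^ (d - 1)) * z) w := by
  have hmul : HasDerivAt (fun w => w * z) z w := by simpa using (hasDerivAt_id w).mul_const z
  have hlead := (hmul.pow d).neg.div_const (d : ℂ)
  have hsum := HasDerivAt.fun_sum (u := Finset.Ico 1 d)
    (fun k _ => (hmul.pow k).const_mul (a k))
  have hd' : (d : ℂ) ≠ 0 := Nat.cast_ne_zero.mpr hd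
  convert! hlead.add hsum using 1
  rw [sub_mul, Finset.sum_mul, sub_eq_neg_add]
  congr 1
  · field_simp
  · exact Finset.sum_congr rfl fun k _ => by ring

lemma intervalIntegrable_cpow_sub_one_mul {s : ℂ} (hs : 0 < s.re) {f : ℂ → ℂ}
    (hf : Continuous f) (z : ℂ) :
    IntervalIntegrable (fun u : ℝ => (u : ℂ) ^ (s - 1) * f (u * z) * Complex.exp (P0 d a (u * z)))
      volume 0 1 := by
  simp only [mul_assoc]
  refine (intervalIntegral.intervalIntegrable_cpow' (by simpa using hs)).mul_continuousOn ?_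
  have := continuous_P0 (d := d) (a := a)
  fun_prop

lemma OmegaInc_add_natCast (s : ℂ) {z : ℂ} (hz : z ≠ 0) (n : ℕ) :
    OmegaInc d a (s + n) z = z ^ s *
      ∫ u in (0 : ℝ)..1, (u : ℂ) ^ (s - 1) * (u * z) ^ n * Complex.exp (P0 d a (u * z)) := by
  rw [OmegaInc, Complex.cpow_add _ _ hz, Complex.cpow_natCast, mul_assoc,
    ← intervalIntegral.integral_const_mul]
  congr 1
  refine intervalIntegral.integral_congr_Ioo_of_le zero_le_one fun u hu => ?_
  have hu' : (u : ℂ) ≠ 0 := Complex.ofReal_ne_zero.mpr hu.1.ne'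
  rw [add_sub_right_comm, Complex.cpow_add _ _ hu', Complex.cpow_natCast]
  ring

/-- Integration by parts for the Incomplete Omega function. -/
lemma integral_cpow_mul_deriv_P0 (hd : d ≠ 0) {s : ℂ} (hs : 0 < s.re) (z : ℂ) :
    ∫ u in (0 : ℝ)..1, (u : ℂ) ^ (s - 1) *
        (s + ∑ k ∈ Finset.Ico 1 d, k * a k * (u * z) ^ k - (u * z) ^ d) *
        Complex.exp (P0 d a (u * z)) = Complex.exp (P0 d a z) := by
  have hs0 : s ≠ 0 := fun h => by simp [h] at hs
  rw [intervalIntegral.integral_eq_sub_of_hasDerivAt_of_le zero_le_one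
    (f := fun u : ℝ => (u : ℂ) ^ s * Complex.exp (P0 d a (u * z)))]
  · simp [hs0]
  · have := continuous_P0 (d := d) (a := a)
    have := Complex.continuous_ofReal_cpow_const hs
    fun_prop
  · intro u hu
    have hu' : (u : ℂ) ≠ 0 := Complex.ofReal_ne_zero.mpr hu.1.ne'
    convert! (hasDerivAt_ofReal_cpow_const hu.1.ne' hs0).mul
      (hasDerivAt_P0_mul (a := a) hd u z).cexp.comp_ofReal using 1
    have hpow : (u : ℂ) ^ s = (u : ℂ) ^ (s - 1) * u := by
      rw [Complex.cpow_sub _ _ hu', Complex.cpow_one, div_mul_cancel₀ _ hu']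
    have hsum : ∑ k ∈ Finset.Ico 1 d, k * a k * (u * z) ^ k =
        (∑ k ∈ Finset.Ico 1 d, k * a k * (u * z) ^ (k - 1)) * (u * z) := by
      rw [Finset.sum_mul]
      refine Finset.sum_congr rfl fun k hk => ?_
      rw [mul_assoc _ _ (u * z), pow_sub_one_mul (by grind)]
    rw [hpow, hsum, ← pow_sub_one_mul hd]
    ring
  · exact intervalIntegrable_cpow_sub_one_mul hs
      (f := fun t => s + ∑ k ∈ Finset.Ico 1 d, k * a k * t ^ k - t ^ d) (by fun_prop) z

lemma OmegaInc_add_degree (hd : d ≠ 0) {s : ℂ} (hs : 0 < s.re) {z : ℂ} (hz : z ≠ 0) :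
    OmegaInc d a (s + d) z = s * OmegaInc d a s z +
      ∑ k ∈ Finset.Ico 1 d, k * a k * OmegaInc d a (s + k) z -
      z ^ s * Complex.exp (P0 d a z) := by
  have hintegrable (n : ℕ) : IntervalIntegrable (fun u : ℝ =>
      (u : ℂ) ^ (s - 1) * (u * z) ^ n * Complex.exp (P0 d a (u * z))) volume 0 1 :=
    intervalIntegrable_cpow_sub_one_mul hs (f := fun t => t ^ n) (by fun_prop) z
  have hsum : IntervalIntegrable (fun u : ℝ => ∑ k ∈ Finset.Ico 1 d, k * a k *
      ((u : ℂ) ^ (s - 1) * (u * z) ^ k * Complex.exp (P0 d a (u * z)))) volume 0 1 := by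
    simpa only [Finset.sum_fn] using
      IntervalIntegrable.sum (Finset.Ico 1 d) fun k _ => (hintegrable k).const_mul (k * a k)
  have hzero : OmegaInc d a s z = z ^ s *
      ∫ u in (0 : ℝ)..1, (u : ℂ) ^ (s - 1) * (u * z) ^ 0 * Complex.exp (P0 d a (u * z)) := by
    simpa using OmegaInc_add_natCast (d := d) (a := a) s hz 0
  have hparts : Complex.exp (P0 d a z) =
      s * (∫ u in (0 : ℝ)..1, (u : ℂ) ^ (s - 1) * (u * z) ^ 0 * Complex.exp (P0 d a (u * z))) +
      ∑ k ∈ Finset.Ico 1 d, k * a k *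
        (∫ u in (0 : ℝ)..1, (u : ℂ) ^ (s - 1) * (u * z) ^ k * Complex.exp (P0 d a (u * z))) -
      ∫ u in (0 : ℝ)..1, (u : ℂ) ^ (s - 1) * (u * z) ^ d * Complex.exp (P0 d a (u * z)) := by
    simp only [← intervalIntegral.integral_const_mul]
    rw [← intervalIntegral.integral_finsetSum fun k _ => (hintegrable k).const_mul _,
      ← intervalIntegral.integral_add ((hintegrable 0).const_mul _) hsum,
      ← intervalIntegral.integral_sub (((hintegrable 0).const_mul _).add hsum) (hintegrable d),
      ← integral_cpow_mul_deriv_P0 hd hs]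
    refine intervalIntegral.integral_congr fun u _ => ?_
    simp only [mul_sub, sub_mul, mul_add, add_mul, Finset.mul_sum, Finset.sum_mul]
    congr 2
    · ring
    · exact Finset.sum_congr rfl fun k _ => by ring
  rw [hparts, hzero]
  simp only [OmegaInc_add_natCast s hz, mul_sub, mul_add, Finset.mul_sum]
  simp only [mul_left_comm (z ^ s)]
  ring

/-- `F(s, z)` has the form `z^s A(s, z) e^{P₀(z)} + ∑_{k<d} c_k(s) Ω(s+k, z)` with polynomial
`A` and `c_k`. -/
def IsOmegaReducible (d : ℕ) (a : ℕ → ℂ) (F : ℂ → ℂ → ℂ) : Prop :=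
  ∃ (A : MvPolynomial (Fin 2) ℂ) (c : ℕ → Polynomial ℂ),
    ∀ s : ℂ, 0 < s.re → ∀ z : ℂ, (z.im ≠ 0 ∨ 0 < z.re) →
      F s z = z ^ s * MvPolynomial.eval ![s, z] A * Complex.exp (P0 d a z)
        + ∑ k ∈ Finset.range d, (c k).eval s * OmegaInc d a (s + k) z

namespace IsOmegaReducible

variable {F G : ℂ → ℂ → ℂ}

lemma congr (hF : IsOmegaReducible d a F)
    (h : ∀ s : ℂ, 0 < s.re → ∀ z : ℂ, (z.im ≠ 0 ∨ 0 < z.re) → G s z = F s z) :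
    IsOmegaReducible d a G := by
  obtain ⟨A, c, hA⟩ := hF
  exact ⟨A, c, fun s hs z hz => (h s hs z hz).trans (hA s hs z hz)⟩

lemma add (hF : IsOmegaReducible d a F) (hG : IsOmegaReducible d a G) :
    IsOmegaReducible d a (fun s z => F s z + G s z) := by
  obtain ⟨A, c, hA⟩ := hF
  obtain ⟨B, e, hB⟩ := hG
  refine ⟨A + B, fun k => c k + e k, fun s hs z hz => ?_⟩
  simp only [hA s hs z hz, hB s hs z hz, map_add, Polynomial.eval_add, add_mul,
    Finset.sum_add_distrib]
  ring

lemma polynomial_mul (p : Polynomial ℂ) (hF : IsOmegaReducible d a F) :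
    IsOmegaReducible d a (fun s z => p.eval s * F s z) := by
  obtain ⟨A, c, hA⟩ := hF
  refine ⟨Polynomial.aeval (MvPolynomial.X 0) p * A, fun k => p * c k, fun s hs z hz => ?_⟩
  have hp : MvPolynomial.eval ![s, z] (Polynomial.aeval (MvPolynomial.X 0) p) = p.eval s := by
    rw [← MvPolynomial.coe_aeval_eq_eval, RingHom.coe_coe, ← Polynomial.aeval_algHom_apply]
    simp [Polynomial.aeval_def, Polynomial.eval₂_eq_eval_map]
  simp only [hA s hs z hz, map_mul, hp, Polynomial.eval_mul, mul_add, Finset.mul_sum, mul_assoc]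
  ring

lemma const_mul (b : ℂ) (hF : IsOmegaReducible d a F) :
    IsOmegaReducible d a (fun s z => b * F s z) := by
  simpa using hF.polynomial_mul (Polynomial.C b)

lemma cpow_mul_exp (m : ℕ) :
    IsOmegaReducible d a (fun s z => z ^ s * z ^ m * Complex.exp (P0 d a z)) :=
  ⟨MvPolynomial.X 1 ^ m, 0, fun s _ z _ => by simp⟩

lemma sum {ι : Type*} (t : Finset ι) {f : ι → ℂ → ℂ → ℂ}
    (hf : ∀ i ∈ t, IsOmegaReducible d a (f i)) :
    IsOmegaReducible d a (fun s z => ∑ i ∈ t, f i s z) := by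
  classical
  induction t using Finset.induction_on with
  | empty => exact ⟨0, 0, by simp⟩
  | insert i t hi ih =>
    simp only [Finset.sum_insert hi]
    exact (hf i (by simp)).add (ih fun j hj => hf j (by simp [hj]))

lemma OmegaInc_add (hd : d ≠ 0) (n : ℕ) :
    IsOmegaReducible d a (fun s z => OmegaInc d a (s + n) z) := by
  induction n using Nat.strong_induction_on with
  | _ n ih =>
    rcases lt_or_ge n d with hn | hn
    · refine ⟨0, fun k => if k = n then 1 else 0, fun s _ z _ => ?_⟩
      rw [Finset.sum_eq_single_of_mem n (by simpa using hn) (fun k _ hk => by simp [hk])]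
      simp
    · obtain ⟨m, rfl⟩ := Nat.exists_eq_add_of_le' hn
      refine ((((ih m (by omega)).polynomial_mul (Polynomial.X + Polynomial.C (m : ℂ))).add
        (IsOmegaReducible.sum (Finset.Ico 1 d) fun k hk =>
          (ih (m + k) (by grind)).const_mul (k * a k))).add
        ((cpow_mul_exp m).const_mul (-1))).congr fun s hs z hz => ?_
      have hz0 : z ≠ 0 := by
        rintro rfl
        simp at hz
      have hsm : 0 < (s + m).re := by
        simp only [Complex.add_re, Complex.natCast_re]
        positivity
      have hrec := OmegaInc_add_degree (a := a) hd hsm hz0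
      simp only [Nat.cast_add, ← add_assoc, Polynomial.eval_add, Polynomial.eval_X,
        Polynomial.eval_C]
      rw [hrec, Complex.cpow_add _ _ hz0, Complex.cpow_natCast]
      ring

end IsOmegaReducible

lemma integral_eq_sum_OmegaInc (Q : Polynomial ℂ) {s : ℂ} (hs : 0 < s.re) {z : ℂ} (hz : z ≠ 0) :
    z ^ (s + 1) * (∫ u in (0 : ℝ)..1,
        (u : ℂ) ^ s * Q.eval ((u : ℂ) * z) * Complex.exp (P0 d a ((u : ℂ) * z))) =
      ∑ j ∈ Finset.range (Q.natDegree + 1),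
        Q.coeff j * OmegaInc d a (s + (j + 1 : ℕ)) z := by
  have hintegrable (n : ℕ) : IntervalIntegrable (fun u : ℝ =>
      (u : ℂ) ^ (s - 1) * (u * z) ^ n * Complex.exp (P0 d a (u * z))) volume 0 1 :=
    intervalIntegrable_cpow_sub_one_mul hs (f := fun t => t ^ n) (by fun_prop) z
  simp only [OmegaInc_add_natCast s hz, mul_left_comm _ (z ^ s)]
  rw [← Finset.mul_sum, Complex.cpow_add _ _ hz, Complex.cpow_one, mul_assoc]
  simp only [← intervalIntegral.integral_const_mul (Q.coeff _)]
  rw [← intervalIntegral.integral_finsetSum fun j _ => (hintegrable (j + 1)).const_mul _,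
    ← intervalIntegral.integral_const_mul z]
  congr 1
  refine intervalIntegral.integral_congr_Ioo_of_le zero_le_one fun u hu => ?_
  have hu' : (u : ℂ) ≠ 0 := Complex.ofReal_ne_zero.mpr hu.1.ne'
  have hpow : (u : ℂ) ^ s = (u : ℂ) ^ (s - 1) * u := by
    rw [Complex.cpow_sub _ _ hu', Complex.cpow_one, div_mul_cancel₀ _ hu']
  simp only [hpow, Polynomial.eval_eq_sum_range, Finset.mul_sum, Finset.sum_mul]
  exact Finset.sum_congr rfl fun j _ => by ring

end IncompleteOmega

/-- For `d ≥ 2` and a polynomial `Q`, there are `A ∈ ℂ[s,z]` and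
`c_0,…,c_{d-1} ∈ ℂ[s]` with
`∫_0^z t^s Q(t) e^{P₀(t)} dt = z^s A(s,z) e^{P₀(z)} + ∑_{k=0}^{d-1} c_k(s) Ω(s+k, z)`
for all `Re s > 0` and all `z ∈ ℂ ∖ (-∞,0]`. -/
theorem stmt7 (d : ℕ) (hd : 2 ≤ d) (a : ℕ → ℂ) (Q : Polynomial ℂ) :
    ∃ (A : MvPolynomial (Fin 2) ℂ) (c : ℕ → Polynomial ℂ),
      ∀ s : ℂ, 0 < s.re → ∀ z : ℂ, (z.im ≠ 0 ∨ 0 < z.re) →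
        z ^ (s + 1) *
            ∫ u in (0 : ℝ)..1,
              (u : ℂ) ^ s * Q.eval ((u : ℂ) * z) * Complex.exp (P0 d a ((u : ℂ) * z))
          = z ^ s * MvPolynomial.eval ![s, z] A * Complex.exp (P0 d a z)
            + ∑ k ∈ Finset.range d, (c k).eval s * OmegaInc d a (s + k) z := by
  have hd0 : d ≠ 0 := by omega
  refine (IsOmegaReducible.sum (Finset.range (Q.natDegree + 1)) fun j _ =>
    (IsOmegaReducible.OmegaInc_add (a := a) hd0 (j + 1)).const_mul (Q.coeff j)).congr
      fun s hs z hz => integral_eq_sum_OmegaInc Q hs ?_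
  rintro rfl
  simp at hz
end
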